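/- Let N be a positive integer, let a be an integer with 1 ≤ a ≤ N, and let r be a real number. Then there exists ε > 0 such that for all real u, w with |u|, |w| < ε and all complex numbers α₁, α₂, γ₁, γ₂ satisfying α₁+α₂ = u, α₁α₂ = −rw², γ₁+γ₂ = u, γ₁γ₂ = (1−r)w², one has 1 + Σ_{k ≥ 2n, n ≥ 1} X₀^r(k,n,n) u^{k−2n} w^{2n} = exp(Σ_{n=2}^∞ (t_{N,a}(n)/n)(α₁ⁿ + α₂ⁿ − γ₁ⁿ − γ₂ⁿ)), where both series converge absolutely. -/

import Mathlib

/-- All groupings of an index obtained by replacing each box in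
`k₁ □ k₂ □ ⋯ □ kₙ` by a comma (new block) or a plus (merge). -/
def groupings : List ℕ → List (List ℕ)
  | [] => [[]]
  | [x] => [[x]]
  | x :: y :: rest => ((groupings (y :: rest)).map (x :: ·)) ++ groupings ((x + y) :: rest)
termination_by l => l.length

/-- Multiple t-value of level `N` with residue `a`:
`t_{N,a}(k) = Σ_{m₁ > ⋯ > mₙ > 0, mᵢ ≡ a (mod N)} 1/(m₁^{k₁} ⋯ mₙ^{kₙ})`. -/
noncomputable def tv (N a : ℕ) (k : List ℕ) : ℝ :=
  ∑' m : {f : Fin k.length → ℕ // StrictAnti f ∧ ∀ i, 0 < f i ∧ f i % N = a % N},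
    ∏ i : Fin k.length, ((m.1 i : ℝ) ^ k.get i)⁻¹

/-- Interpolated multiple t-value of level `N`:
`t^r_{N,a}(k) = Σ_p r^{n - dep(p)} t_{N,a}(p)` over all groupings `p` of `k`. -/
noncomputable def itv (N a : ℕ) (r : ℝ) (k : List ℕ) : ℝ :=
  ((groupings k).map (fun p => r ^ (k.length - p.length) * tv N a p)).sum

/-- An index is admissible if all entries are positive and the first entry is at least `2`. -/
def IsAdmissible (k : List ℕ) : Prop := (∀ i ∈ k, 1 ≤ i) ∧ 2 ≤ k.headI

/-- The height of an index: the number of entries that are at least `2`. -/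
def height (k : List ℕ) : ℕ := k.countP (fun i => 2 ≤ i)

/-- `X₀^r(k,n,s)`: sum of interpolated multiple t-values of level `N` over all
admissible indices of weight `k`, depth `n` and height `s`. -/
noncomputable def X0 (N a : ℕ) (r : ℝ) (k n s : ℕ) : ℝ :=
  ∑' l : {l : List ℕ // IsAdmissible l ∧ l.sum = k ∧ l.length = n ∧ height l = s},
    itv N a r l.1

section

open Finset

/-- Truncation of a nested sum over `M > j₁ > ⋯ > jₙ ≥ 0` of `x j₁ ^ k₁ ⋯ x jₙ ^ kₙ`. -/
noncomputable def truncSum (x : ℕ → ℝ) : List ℕ → ℕ → ℝ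
  | [], _ => 1
  | k :: ks, M => ∑ j ∈ range M, x j ^ k * truncSum x ks j

/-- The part of the nested sum in which the largest variable equals `j`. -/
noncomputable def headTerm (x : ℕ → ℝ) (j : ℕ) : List ℕ → ℝ
  | [] => 0
  | k :: ks => x j ^ k * truncSum x ks j

/-- The interpolated nested sum over `j ≥ j₁ ≥ ⋯ ≥ jₙ ≥ 0`, in which every equality
(including `j = j₁`) carries a factor `r`. -/
noncomputable def interpSum (x : ℕ → ℝ) (r : ℝ) : List ℕ → ℕ → ℝ
  | [], _ => 1
  | k :: ks, j => ∑ i ∈ range j, x i ^ k * interpSum x r ks i + r * (x j ^ k * interpSum x r ks j)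

theorem mem_groupings_cons {k : ℕ} {ks p : List ℕ} (hp : p ∈ groupings (k :: ks)) :
    p ≠ [] ∧ p.length ≤ ks.length + 1 := by
  induction ks generalizing k p with
  | nil => simp [groupings] at hp; simp [hp]
  | cons y rest ih =>
    rw [groupings, List.mem_append, List.mem_map] at hp
    rcases hp with ⟨q, hq, rfl⟩ | hp
    · simpa using (ih hq).2
    · have := ih hp
      exact ⟨this.1, by simp; omega⟩

theorem two_le_of_mem_groupings {k : ℕ} {ks p : List ℕ} (hk : ∀ i ∈ k :: ks, 2 ≤ i)
    (hp : p ∈ groupings (k :: ks)) : ∀ i ∈ p, 2 ≤ i := by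
  induction ks generalizing k p with
  | nil => simp [groupings] at hp; simpa [hp] using hk
  | cons y rest ih =>
    simp only [List.mem_cons, forall_eq_or_imp] at hk ih
    rw [groupings, List.mem_append, List.mem_map] at hp
    rcases hp with ⟨q, hq, rfl⟩ | hp
    · intro i hi
      rcases List.mem_cons.1 hi with rfl | hi
      · exact hk.1
      · exact ih hk.2 hq i hi
    · exact ih ⟨by omega, hk.2.2⟩ hp

theorem truncSum_eq_sum_headTerm (x : ℕ → ℝ) {p : List ℕ} (hp : p ≠ []) (M : ℕ) :
    truncSum x p M = ∑ j ∈ range M, headTerm x j p := by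
  cases p with
  | nil => exact absurd rfl hp
  | cons k ks => rfl

theorem sum_groupings_headTerm (x : ℕ → ℝ) (r : ℝ) (k : ℕ) (ks : List ℕ) (j : ℕ) :
    ((groupings (k :: ks)).map
      (fun p => r ^ ((k :: ks).length - p.length) * headTerm x j p)).sum =
      x j ^ k * interpSum x r ks j := by
  induction ks generalizing k j with
  | nil => simp [groupings, headTerm, truncSum, interpSum]
  | cons y rest ih =>
    rw [groupings, List.map_append, List.sum_append, List.map_map]
    have h1 : ((groupings (y :: rest)).map
        ((fun p => r ^ ((k :: y :: rest).length - p.length) * headTerm x j p) ∘ (k :: ·))) =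
        (groupings (y :: rest)).map (fun p => x j ^ k * ∑ i ∈ range j,
          r ^ ((y :: rest).length - p.length) * headTerm x i p) := by
      refine List.map_congr_left fun p hp => ?_
      simp only [Function.comp, List.length_cons, Nat.add_sub_add_right]
      rw [headTerm, truncSum_eq_sum_headTerm x (mem_groupings_cons hp).1, ← mul_sum]
      ring
    have h2 : ((groupings ((k + y) :: rest)).map
        (fun p => r ^ ((k :: y :: rest).length - p.length) * headTerm x j p)) =
        (groupings ((k + y) :: rest)).map (fun p => r *
          (r ^ (((k + y) :: rest).length - p.length) * headTerm x j p)) := by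
      refine List.map_congr_left fun p hp => ?_
      have := (mem_groupings_cons hp).2
      simp only [List.length_cons]
      rw [show rest.length + 1 + 1 - p.length = rest.length + 1 - p.length + 1 by omega, pow_succ]
      ring
    rw [h1, h2, List.sum_map_mul_left, List.sum_map_mul_left, ih, interpSum]
    have h3 : ((groupings (y :: rest)).map (fun p => ∑ i ∈ range j,
          r ^ ((y :: rest).length - p.length) * headTerm x i p)).sum =
        ∑ i ∈ range j, x i ^ y * interpSum x r rest i := by
      simp_rw [← ih]
      generalize groupings (y :: rest) = l
      induction l with
      | nil => simp
      | cons p l ihl => simp only [List.map_cons, List.sum_cons, ihl, sum_add_distrib]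
    rw [h3]
    ring

theorem HasSum.of_prod_fiberwise_of_nonneg {β γ : Type*} {f : β × γ → ℝ} {g : β → ℝ} {s : ℝ}
    (hf : ∀ p, 0 ≤ f p) (hfg : ∀ b, HasSum (fun c => f (b, c)) (g b)) (hg : HasSum g s) :
    HasSum f s := by
  have hs : Summable f := (summable_prod_of_nonneg hf).2
    ⟨fun b => (hfg b).summable, by simpa only [fun b => (hfg b).tsum_eq] using hg.summable⟩
  have := hs.hasSum.prod_fiberwise hfg
  rw [hg.unique this]
  exact hs.hasSum

theorem strictAnti_cons_iff {n : ℕ} {j : ℕ} {h : Fin n → ℕ} :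
    StrictAnti (Fin.cons j h : Fin (n + 1) → ℕ) ↔ StrictAnti h ∧ ∀ i, h i < j := by
  constructor
  · intro H
    refine ⟨fun a b hab => ?_, fun i => ?_⟩
    · simpa using H (Fin.succ_lt_succ_iff.2 hab)
    · simpa using H (Fin.succ_pos i)
  · rintro ⟨H, hj⟩ a b hab
    induction a using Fin.cases with
    | zero =>
      induction b using Fin.cases with
      | zero => exact absurd hab (lt_irrefl _)
      | succ b => simpa using hj b
    | succ a =>
      induction b using Fin.cases with
      | zero => simp at hab
      | succ b => simpa using H (Fin.succ_lt_succ_iff.1 hab)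

open Classical in
theorem hasSum_strictAnti_cons {x : ℕ → ℝ} (hx : ∀ j, 0 ≤ x j) {q : ℕ → Prop}
    (hq : ∀ i j, i < j → q j → q i) {k : ℕ} {ks : List ℕ} {s : ℝ}
    (hks : ∀ j, HasSum (fun h : Fin ks.length → ℕ =>
      if StrictAnti h ∧ ∀ i, h i < j then ∏ i, x (h i) ^ ks.get i else 0) (truncSum x ks j))
    (hs : HasSum (fun j => if q j then x j ^ k * truncSum x ks j else 0) s) :
    HasSum (fun h : Fin (k :: ks).length → ℕ =>
      if StrictAnti h ∧ ∀ i, q (h i) then ∏ i, x (h i) ^ (k :: ks).get i else 0) s := by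
  have key := HasSum.of_prod_fiberwise_of_nonneg
    (f := fun p : ℕ × (Fin ks.length → ℕ) => if q p.1 then x p.1 ^ k *
      (if StrictAnti p.2 ∧ ∀ i, p.2 i < p.1 then ∏ i, x (p.2 i) ^ ks.get i else 0) else 0)
    (fun p => by
      have : 0 ≤ ∏ i, x (p.2 i) ^ ks.get i := prod_nonneg fun i _ => pow_nonneg (hx _) _
      have := pow_nonneg (hx p.1) k
      split_ifs <;> positivity)
    (fun j => by
      by_cases hj : q j
      · simpa only [hj, if_true] using (hks j).mul_left (x j ^ k)
      · simpa only [hj, if_false] using hasSum_zero) hs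
  refine ((Fin.consEquiv (fun _ : Fin (ks.length + 1) => ℕ)).hasSum_iff
    (f := fun h : Fin (ks.length + 1) → ℕ =>
      if StrictAnti h ∧ ∀ i, q (h i) then ∏ i, x (h i) ^ (k :: ks).get i else 0)).1 ?_
  convert key using 1
  funext ⟨j, h⟩
  simp only [Function.comp, Fin.consEquiv, Equiv.coe_fn_mk, strictAnti_cons_iff, Fin.prod_univ_succ,
    Fin.forall_fin_succ, Fin.cons_zero, Fin.cons_succ, List.get_cons_zero, List.get_cons_succ']
  by_cases hj : q j
  · by_cases hh : StrictAnti h ∧ ∀ i, h i < j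
    · have : ∀ i, q (h i) := fun i => hq _ _ (hh.2 i) hj
      simp [hh, hj, this]
    · simp [hh, hj]
  · simp [hj]

theorem truncSum_nonneg {x : ℕ → ℝ} (hx : ∀ j, 0 ≤ x j) (ks : List ℕ) (M : ℕ) :
    0 ≤ truncSum x ks M := by
  induction ks generalizing M with
  | nil => simp [truncSum]
  | cons k ks ih => exact sum_nonneg fun j _ => mul_nonneg (pow_nonneg (hx j) k) (ih j)

theorem truncSum_le {x : ℕ → ℝ} (hx : ∀ j, 0 ≤ x j) (hx1 : ∀ j, x j ≤ 1)
    (hs : Summable fun j => x j ^ 2) {ks : List ℕ} (hks : ∀ i ∈ ks, 2 ≤ i) (M : ℕ) :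
    truncSum x ks M ≤ (∑' j, x j ^ 2) ^ ks.length := by
  induction ks generalizing M with
  | nil => simp [truncSum]
  | cons k ks ih =>
    simp only [List.mem_cons, forall_eq_or_imp] at hks
    have hC : 0 ≤ ∑' j, x j ^ 2 := tsum_nonneg fun j => sq_nonneg _
    calc truncSum x (k :: ks) M
        ≤ ∑ j ∈ range M, x j ^ 2 * (∑' j, x j ^ 2) ^ ks.length :=
          sum_le_sum fun j _ => mul_le_mul (pow_le_pow_of_le_one (hx j) (hx1 j) hks.1)
            (ih hks.2 j) (truncSum_nonneg hx _ _) (sq_nonneg _)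
      _ ≤ (∑' j, x j ^ 2) * (∑' j, x j ^ 2) ^ ks.length := by
          rw [← sum_mul]
          exact mul_le_mul_of_nonneg_right (hs.sum_le_tsum _ fun j _ => sq_nonneg _)
            (pow_nonneg hC _)
      _ = _ := by rw [List.length_cons, pow_succ']

theorem summable_headTerm {x : ℕ → ℝ} (hx : ∀ j, 0 ≤ x j) (hx1 : ∀ j, x j ≤ 1)
    (hs : Summable fun j => x j ^ 2) {p : List ℕ} (hp : ∀ i ∈ p, 2 ≤ i) :
    Summable fun j => headTerm x j p := by
  cases p with
  | nil => exact summable_zero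
  | cons k ks =>
    simp only [List.mem_cons, forall_eq_or_imp] at hp
    refine Summable.of_nonneg_of_le
      (fun j => mul_nonneg (pow_nonneg (hx j) k) (truncSum_nonneg hx ks j)) (fun j => ?_)
      (hs.mul_right ((∑' j, x j ^ 2) ^ ks.length))
    exact mul_le_mul (pow_le_pow_of_le_one (hx j) (hx1 j) hp.1)
      (truncSum_le hx hx1 hs hp.2 j) (truncSum_nonneg hx _ _) (sq_nonneg _)

open Classical in
theorem hasSum_truncSum {x : ℕ → ℝ} (hx : ∀ j, 0 ≤ x j) (ks : List ℕ) (M : ℕ) :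
    HasSum (fun h : Fin ks.length → ℕ =>
      if StrictAnti h ∧ ∀ i, h i < M then ∏ i, x (h i) ^ ks.get i else 0) (truncSum x ks M) := by
  induction ks generalizing M with
  | nil =>
    have : Unique (Fin ([] : List ℕ).length → ℕ) := inferInstanceAs (Unique (Fin 0 → ℕ))
    convert hasSum_unique _ using 1
    swap
    · exact this
    have h0 : IsEmpty (Fin ([] : List ℕ).length) := inferInstanceAs (IsEmpty (Fin 0))
    rw [if_pos ⟨fun a => isEmptyElim a, fun a => isEmptyElim a⟩, truncSum]
    exact (prod_of_isEmpty _).symm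
  | cons k ks ih =>
    have hs : HasSum (fun j => if j < M then x j ^ k * truncSum x ks j else 0)
        (truncSum x (k :: ks) M) := by
      have e : truncSum x (k :: ks) M =
          ∑ j ∈ range M, if j < M then x j ^ k * truncSum x ks j else 0 :=
        sum_congr rfl fun j hj => (if_pos (mem_range.1 hj)).symm
      rw [e]
      exact hasSum_sum_of_ne_finset_zero fun j hj => if_neg (by simpa using hj)
    have := hasSum_strictAnti_cons (q := (· < M)) hx (fun i j hij hj => hij.trans hj) ih
      (by convert hs)
    convert this

theorem hasSum_headTerm_tv {N a : ℕ} (hN : 1 ≤ N) (ha1 : 1 ≤ a) (ha2 : a ≤ N)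
    {x : ℕ → ℝ} (hxdef : ∀ j, x j = ((a + N * j : ℕ) : ℝ)⁻¹) (hx1 : ∀ j, x j ≤ 1)
    (hs : Summable fun j => x j ^ 2) {p : List ℕ} (hne : p ≠ []) (hp : ∀ i ∈ p, 2 ≤ i) :
    HasSum (fun j => headTerm x j p) (tv N a p) := by
  classical
  have hx : ∀ j, 0 ≤ x j := fun j => by rw [hxdef]; positivity
  have hsum := (summable_headTerm hx hx1 hs hp).hasSum
  convert hsum using 1
  have hA : StrictMono fun j => a + N * j := fun i j hij => by
    have := Nat.mul_lt_mul_of_pos_left hij hN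
    dsimp only; omega
  have hall : HasSum (fun h : Fin p.length → ℕ =>
      if StrictAnti h then ∏ i, x (h i) ^ p.get i else 0) (∑' j, headTerm x j p) := by
    cases p with
    | nil => exact absurd rfl hne
    | cons k ks =>
      have := hasSum_strictAnti_cons hx (q := fun _ => True) (k := k) (fun _ _ _ _ => trivial)
        (hasSum_truncSum hx ks) (by simpa only [if_true, headTerm] using hsum)
      simpa only [implies_true, and_true, headTerm] using this
  rw [← hall.tsum_eq]
  have h1 : (∑' h : Fin p.length → ℕ, if StrictAnti h then ∏ i, x (h i) ^ p.get i else 0) =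
      ∑' h : {h : Fin p.length → ℕ | StrictAnti h}, ∏ i, x (h.1 i) ^ p.get i := by
    rw [tsum_subtype {h : Fin p.length → ℕ | StrictAnti h} fun h => ∏ i, x (h i) ^ p.get i]
    simp only [Set.indicator_apply, Set.mem_ofPred_eq]
  rw [h1, tv]
  let φ : {h : Fin p.length → ℕ | StrictAnti h} →
      {f : Fin p.length → ℕ // StrictAnti f ∧ ∀ i, 0 < f i ∧ f i % N = a % N} :=
    fun h => ⟨fun i => a + N * h.1 i, hA.comp_strictAnti h.2, fun i => ⟨by positivity, by simp⟩⟩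
  have hφ : Function.Bijective φ := by
    constructor
    · rintro ⟨h, hh⟩ ⟨h', hh'⟩ e
      refine Subtype.ext (funext fun i => hA.injective ?_)
      exact congrFun (congrArg Subtype.val e) i
    · rintro ⟨f, hf, hf'⟩
      have hfi : ∀ i, a + N * ((f i - a) / N) = f i := fun i => by
        obtain ⟨h0, hm⟩ := hf' i
        have hle : a ≤ f i := by
          rcases ha2.lt_or_eq with h | h
          · rw [Nat.mod_eq_of_lt h] at hm
            exact hm ▸ Nat.mod_le _ _
          · subst h
            rw [Nat.mod_self] at hm
            exact Nat.le_of_dvd h0 (Nat.dvd_of_mod_eq_zero hm)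
        have : N ∣ f i - a := (Nat.modEq_iff_dvd' hle).1 hm.symm
        rw [Nat.mul_div_cancel' this]
        omega
      refine ⟨⟨fun i => (f i - a) / N, fun i j hij => ?_⟩, Subtype.ext (funext hfi)⟩
      refine hA.lt_iff_lt.1 ?_
      simpa only [hfi] using hf hij
  refine ((Equiv.ofBijective φ hφ).tsum_eq _).symm.trans (tsum_congr fun h => ?_)
  refine prod_congr rfl fun i _ => ?_
  rw [hxdef, inv_pow]
  rfl

theorem hasSum_interpSum_itv {N a : ℕ} (hN : 1 ≤ N) (ha1 : 1 ≤ a) (ha2 : a ≤ N) (r : ℝ)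
    {x : ℕ → ℝ} (hxdef : ∀ j, x j = ((a + N * j : ℕ) : ℝ)⁻¹) (hx1 : ∀ j, x j ≤ 1)
    (hs : Summable fun j => x j ^ 2) {k : ℕ} {ks : List ℕ} (hk : ∀ i ∈ k :: ks, 2 ≤ i) :
    HasSum (fun j => x j ^ k * interpSum x r ks j) (itv N a r (k :: ks)) := by
  simp_rw [← sum_groupings_headTerm, itv]
  have H : ∀ p ∈ groupings (k :: ks), HasSum (fun j => headTerm x j p) (tv N a p) :=
    fun p hp => hasSum_headTerm_tv hN ha1 ha2 hxdef hx1 hs (mem_groupings_cons hp).1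
      (two_le_of_mem_groupings hk hp)
  generalize groupings (k :: ks) = l at H
  induction l with
  | nil => simp
  | cons p l ih =>
    simp only [List.map_cons, List.sum_cons]
    exact ((H p (by simp)).mul_left _).add (ih fun q hq => H q (by simp [hq]))

theorem interpSum_nonneg {x : ℕ → ℝ} (hx : ∀ j, 0 ≤ x j) {r : ℝ} (hr : 0 ≤ r) (l : List ℕ)
    (j : ℕ) : 0 ≤ interpSum x r l j := by
  induction l generalizing j with
  | nil => simp [interpSum]
  | cons k ks ih =>
    have h : ∀ i, 0 ≤ x i ^ k * interpSum x r ks i :=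
      fun i => mul_nonneg (pow_nonneg (hx i) k) (ih i)
    exact add_nonneg (sum_nonneg fun i _ => h i) (mul_nonneg hr (h j))

theorem abs_interpSum_le {x : ℕ → ℝ} (hx : ∀ j, 0 ≤ x j) (r : ℝ) (l : List ℕ) (j : ℕ) :
    |interpSum x r l j| ≤ interpSum x |r| l j := by
  induction l generalizing j with
  | nil => simp [interpSum]
  | cons k ks ih =>
    have h : ∀ i, |x i ^ k * interpSum x r ks i| ≤ x i ^ k * interpSum x |r| ks i := fun i => by
      rw [abs_mul, abs_of_nonneg (pow_nonneg (hx i) k)]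
      exact mul_le_mul_of_nonneg_left (ih i) (pow_nonneg (hx i) k)
    refine (abs_add_le _ _).trans (add_le_add ?_ ?_)
    · exact (abs_sum_le_sum_abs _ _).trans (sum_le_sum fun i _ => h i)
    · rw [abs_mul]
      exact mul_le_mul_of_nonneg_left (h j) (abs_nonneg r)

theorem hasSum_of_hasSum_cons {α : Type*} {f : List α → ℝ} {s : ℝ}
    (h : HasSum (fun p : α × List α => f (p.1 :: p.2)) s) : HasSum f (f [] + s) := by
  classical
  have hinj : Function.Injective fun p : α × List α => p.1 :: p.2 := by
    rintro ⟨k, ks⟩ ⟨k', ks'⟩ e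
    simpa using e
  have h2 : HasSum (fun l => if l = [] then 0 else f l) s := by
    rw [← hinj.hasSum_iff]
    · simpa [Function.comp_def] using h
    · intro l hl
      cases l with
      | nil => simp
      | cons k ks => exact absurd ⟨(k, ks), rfl⟩ hl
  convert (hasSum_ite_eq ([] : List α) (f [])).add h2 using 1
  funext l
  by_cases hl : l = [] <;> simp [hl]

theorem HasSum.prod_mul {ι κ : Type*} {f : ι → ℝ} {g : κ → ℝ} {s t : ℝ} (hf : HasSum f s)
    (hg : HasSum g t) : HasSum (fun p : ι × κ => f p.1 * g p.2) (s * t) :=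
  hf.mul hg (summable_mul_of_summable_norm hf.summable.norm hg.summable.norm)

/-- One step of the recursion for generating functions of interpolated nested sums. -/
theorem hasSum_interp_step {x g y : ℕ → ℝ} {r : ℝ}
    (hy : ∀ j, HasSum (fun k => g k * x j ^ k) (y j)) {φ : List ℕ → ℕ → ℝ} {S : ℕ → ℝ}
    (hφ : ∀ j, HasSum (fun l => φ l j) (S j)) (j : ℕ) :
    HasSum (fun p : ℕ × List ℕ => ∑ i ∈ range j, g p.1 * x i ^ p.1 * φ p.2 i +
      r * (g p.1 * x j ^ p.1 * φ p.2 j)) (∑ i ∈ range j, y i * S i + r * (y j * S j)) :=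
  (hasSum_sum fun i _ => (hy i).prod_mul (hφ i)).add (((hy j).prod_mul (hφ j)).mul_left r)

theorem prod_map_mul_interpSum_cons (x g : ℕ → ℝ) (r : ℝ) (k : ℕ) (ks : List ℕ) (j : ℕ) :
    ((k :: ks).map g).prod * interpSum x r (k :: ks) j =
      ∑ i ∈ range j, g k * x i ^ k * ((ks.map g).prod * interpSum x r ks i) +
        r * (g k * x j ^ k * ((ks.map g).prod * interpSum x r ks j)) := by
  rw [interpSum, List.map_cons, List.prod_cons, mul_add, mul_sum]
  congr 1
  · exact sum_congr rfl fun i _ => by ring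
  · ring

theorem summable_prod_map_mul_interpSum {x g y : ℕ → ℝ} {r Y : ℝ} (hx : ∀ j, 0 ≤ x j)
    (hg : ∀ k, 0 ≤ g k) (hr : 0 ≤ r) (hy : ∀ j, HasSum (fun k => g k * x j ^ k) (y j))
    (hY : HasSum y Y) (hρ : Y * (1 + r) < 1) (j : ℕ) :
    Summable (fun l : List ℕ => (l.map g).prod * interpSum x r l j) ∧
      ∑' l : List ℕ, (l.map g).prod * interpSum x r l j ≤ 1 / (1 - Y * (1 + r)) := by
  set C := 1 / (1 - Y * (1 + r)) with hC
  have hC0 : 0 < C := one_div_pos.2 (by linarith)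
  have hC1 : 1 + Y * (1 + r) * C = C := by
    rw [hC]
    have : 1 - Y * (1 + r) ≠ 0 := by linarith
    field_simp
    ring
  have hy0 : ∀ j, 0 ≤ y j := fun j =>
    (hy j).nonneg fun k => mul_nonneg (hg k) (pow_nonneg (hx j) k)
  have hYj : ∀ j, y j ≤ Y := fun j => le_hasSum hY j fun i _ => hy0 i
  have hf0 : ∀ (l : List ℕ) j, 0 ≤ (l.map g).prod * interpSum x r l j := fun l j =>
    mul_nonneg (List.prod_nonneg (by simpa using fun k _ => hg k)) (interpSum_nonneg hx hr l j)
  have claim : ∀ n j, ∃ s ≤ C, HasSum (fun l : List ℕ =>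
      if l.length < n then (l.map g).prod * interpSum x r l j else 0) s := by
    intro n
    induction n with
    | zero => exact fun j => ⟨0, hC0.le, by simp⟩
    | succ n ih =>
      intro j
      choose S hSC hS using ih
      have h1 := hasSum_interp_step (r := r) hy hS j
      refine ⟨1 + (∑ i ∈ range j, y i * S i + r * (y j * S j)), ?_, ?_⟩
      · have h2 : ∑ i ∈ range j, y i * S i ≤ Y * C := by
          refine (sum_le_sum fun i _ => mul_le_mul_of_nonneg_left (hSC i) (hy0 i)).trans ?_
          rw [← sum_mul]
          exact mul_le_mul_of_nonneg_right (sum_le_hasSum _ (fun i _ => hy0 i) hY) hC0.le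
        have h3 : r * (y j * S j) ≤ r * (Y * C) := by
          refine mul_le_mul_of_nonneg_left ?_ hr
          exact (mul_le_mul_of_nonneg_left (hSC j) (hy0 j)).trans
            (mul_le_mul_of_nonneg_right (hYj j) hC0.le)
        calc 1 + (∑ i ∈ range j, y i * S i + r * (y j * S j))
            ≤ 1 + (Y * C + r * (Y * C)) := by gcongr
          _ = C := by linear_combination hC1
      · have h2 := hasSum_of_hasSum_cons
          (f := fun l : List ℕ => if l.length < n + 1 then (l.map g).prod * interpSum x r l j else 0)
          (s := ∑ i ∈ range j, y i * S i + r * (y j * S j)) ?_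
        · simpa [interpSum] using h2
        · convert h1 using 1
          funext p
          by_cases hp : p.2.length < n
          · simp only [List.length_cons, Nat.add_lt_add_iff_right, hp, if_true,
              prod_map_mul_interpSum_cons]
          · simp [hp]
  have bound : ∀ u : Finset (List ℕ), ∑ l ∈ u, (l.map g).prod * interpSum x r l j ≤ C := by
    intro u
    obtain ⟨s, hsC, hs⟩ := claim (u.sup List.length + 1) j
    refine le_trans (le_of_eq (sum_congr rfl fun l hl => ?_)) ((sum_le_hasSum u ?_ hs).trans hsC)
    · rw [if_pos (Nat.lt_succ_of_le (le_sup (f := List.length) hl))]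
    · intro l _
      split_ifs
      exacts [hf0 l j, le_rfl]
  exact ⟨summable_of_sum_le (fun l => hf0 l j) bound,
    Real.tsum_le_of_sum_le (fun l => hf0 l j) bound⟩

theorem exists_hasSum_interpSum {x g y ya : ℕ → ℝ} {r Y : ℝ} (hx : ∀ j, 0 ≤ x j)
    (hy : ∀ j, HasSum (fun k => g k * x j ^ k) (y j))
    (hya : ∀ j, HasSum (fun k => |g k| * x j ^ k) (ya j))
    (hY : HasSum ya Y) (hρ : Y * (1 + |r|) < 1) :
    ∃ s, HasSum (fun p : (ℕ × List ℕ) × ℕ => g p.1.1 * (p.1.2.map g).prod *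
        (x p.2 ^ p.1.1 * interpSum x r p.1.2 p.2)) s ∧
      Filter.Tendsto (fun M => ∏ j ∈ range M, (1 + y j / (1 - r * y j))) Filter.atTop
        (nhds (1 + s)) := by
  have hya0 : ∀ j, 0 ≤ ya j := fun j =>
    (hya j).nonneg fun k => mul_nonneg (abs_nonneg _) (pow_nonneg (hx j) k)
  have hA := summable_prod_map_mul_interpSum hx (fun k => abs_nonneg (g k)) (abs_nonneg r)
    hya hY hρ
  have hprod : ∀ l : List ℕ, |(l.map g).prod| = (l.map fun k => |g k|).prod := fun l => by
    induction l with
    | nil => simp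
    | cons k l ih => simp [abs_mul, ih]
  have hle : ∀ (l : List ℕ) j, |(l.map g).prod * interpSum x r l j| ≤
      (l.map fun k => |g k|).prod * interpSum x |r| l j := fun l j => by
    rw [abs_mul, hprod]
    exact mul_le_mul_of_nonneg_left (abs_interpSum_le hx r l j) (hprod l ▸ abs_nonneg _)
  have hS : ∀ j, Summable fun l : List ℕ => (l.map g).prod * interpSum x r l j := fun j =>
    Summable.of_norm_bounded (hA j).1 fun l => hle l j
  set Ω : ℕ → ℝ := fun j => ∑' l : List ℕ, (l.map g).prod * interpSum x r l j with hΩ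
  have hΩs : ∀ j, HasSum (fun l : List ℕ => (l.map g).prod * interpSum x r l j) (Ω j) :=
    fun j => (hS j).hasSum
  have hrec : ∀ j, Ω j = 1 + (∑ i ∈ range j, y i * Ω i + r * (y j * Ω j)) := fun j => by
    have h1 := hasSum_interp_step (r := r) hy hΩs j
    have h2 := hasSum_of_hasSum_cons
      (f := fun l : List ℕ => (l.map g).prod * interpSum x r l j)
      (by simpa only [prod_map_mul_interpSum_cons] using h1)
    simpa [interpSum] using (hΩs j).unique h2
  have hne : ∀ j, 1 - r * y j ≠ 0 := fun j => by
    have h1 : |y j| ≤ ya j := by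
      refine (hy j).norm_le_of_bounded (hya j) fun k => ?_
      rw [norm_mul, Real.norm_eq_abs, Real.norm_eq_abs, abs_of_nonneg (pow_nonneg (hx j) k)]
    have h2 : ya j ≤ Y := le_hasSum hY j fun i _ => hya0 i
    have h3 : |r * y j| < 1 := by
      rw [abs_mul]
      nlinarith [abs_nonneg r, mul_le_mul_of_nonneg_left (h1.trans h2) (abs_nonneg r), hya0 j]
    have := (abs_lt.1 h3).2
    linarith
  have hP : ∀ M, 1 + ∑ j ∈ range M, y j * Ω j = ∏ j ∈ range M, (1 + y j / (1 - r * y j)) := by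
    intro M
    induction M with
    | zero => simp
    | succ M ih =>
      rw [sum_range_succ, prod_range_succ, ← ih]
      have := hne M
      have hM := hrec M
      generalize ∑ j ∈ range M, y j * Ω j = T at *
      have hT : 1 + T = Ω M * (1 - r * y M) := by linear_combination -hM
      rw [← add_assoc, hT]
      field_simp
  have hsum : Summable fun p : ℕ × (ℕ × List ℕ) =>
      g p.2.1 * x p.1 ^ p.2.1 * ((p.2.2.map g).prod * interpSum x r p.2.2 p.1) := by
    refine Summable.of_norm_bounded (g := fun p : ℕ × (ℕ × List ℕ) => |g p.2.1| * x p.1 ^ p.2.1 *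
      ((p.2.2.map fun k => |g k|).prod * interpSum x |r| p.2.2 p.1)) ?_ fun p => ?_
    · have hj := fun j => (hya j).prod_mul (hA j).1.hasSum
      refine (summable_prod_of_nonneg fun p => ?_).2 ⟨fun j => (hj j).summable, ?_⟩
      · exact mul_nonneg (mul_nonneg (abs_nonneg _) (pow_nonneg (hx _) _))
          ((abs_nonneg _).trans (hle _ _))
      · simp only [fun j => (hj j).tsum_eq]
        refine Summable.of_nonneg_of_le (fun j => mul_nonneg (hya0 j) (tsum_nonneg fun l =>
          (abs_nonneg _).trans (hle l j))) (fun j => ?_)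
          (hY.summable.mul_right (1 / (1 - Y * (1 + |r|))))
        exact mul_le_mul_of_nonneg_left (hA j).2 (hya0 j)
    · rw [norm_mul, norm_mul, Real.norm_eq_abs, Real.norm_eq_abs, Real.norm_eq_abs,
        abs_of_nonneg (pow_nonneg (hx p.1) p.2.1)]
      exact mul_le_mul_of_nonneg_left (hle _ _)
        (mul_nonneg (abs_nonneg _) (pow_nonneg (hx _) _))
  have hfib := hsum.hasSum.prod_fiberwise fun j => (hy j).prod_mul (hΩs j)
  refine ⟨_, ?_, by simpa only [hP] using hfib.tendsto_sum_nat.const_add 1⟩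
  convert (Equiv.prodComm (ℕ × List ℕ) ℕ).hasSum_iff.2 hsum.hasSum using 1
  funext p
  simp only [Function.comp, Equiv.prodComm_apply, Prod.fst_swap, Prod.snd_swap]
  ring

theorem hasSum_congr {ι M : Type*} [AddCommMonoid M] [TopologicalSpace M] {f g : ι → M} {s : M}
    (h : ∀ i, f i = g i) : HasSum f s ↔ HasSum g s := by
  rw [funext h]

/-- The weight `u ^ (k - 2) * w ^ 2` carried by an entry `k ≥ 2` of an index. -/
noncomputable def entryWeight (u w : ℝ) (k : ℕ) : ℝ := if 2 ≤ k then u ^ (k - 2) * w ^ 2 else 0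

theorem prod_map_entryWeight (u w : ℝ) {l : List ℕ} (hl : ∀ i ∈ l, 2 ≤ i) :
    2 * l.length ≤ l.sum ∧
      (l.map (entryWeight u w)).prod = u ^ (l.sum - 2 * l.length) * w ^ (2 * l.length) := by
  induction l with
  | nil => simp
  | cons k l ih =>
    simp only [List.mem_cons, forall_eq_or_imp] at hl
    obtain ⟨h1, h2⟩ := ih hl.2
    simp only [List.length_cons, List.sum_cons, List.map_cons, List.prod_cons]
    refine ⟨by omega, ?_⟩
    rw [h2, entryWeight, if_pos hl.1,
      show k + l.sum - 2 * (l.length + 1) = (k - 2) + (l.sum - 2 * l.length) by omega]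
    ring

theorem prod_map_entryWeight_eq_zero (u w : ℝ) {l : List ℕ} (hl : ¬ ∀ i ∈ l, 2 ≤ i) :
    (l.map (entryWeight u w)).prod = 0 := by
  push Not at hl
  obtain ⟨i, hi, hi2⟩ := hl
  exact List.prod_eq_zero (List.mem_map.2 ⟨i, hi, if_neg (by omega)⟩)

theorem maxHeight_iff {l : List ℕ} {k n : ℕ} (hn : 1 ≤ n) :
    (IsAdmissible l ∧ l.sum = k ∧ l.length = n ∧ height l = n) ↔
      (l.sum = k ∧ l.length = n) ∧ ∀ i ∈ l, 2 ≤ i := by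
  constructor
  · rintro ⟨-, h1, h2, h3⟩
    refine ⟨⟨h1, h2⟩, ?_⟩
    have := List.countP_eq_length.1 (h3.trans h2.symm)
    simpa using this
  · rintro ⟨⟨h1, h2⟩, h3⟩
    refine ⟨⟨fun i hi => one_le_two.trans (h3 i hi), ?_⟩, h1, h2, ?_⟩
    · cases l with
      | nil => simp at h2; omega
      | cons k l => exact h3 _ (by simp)
    · rw [← h2]
      exact List.countP_eq_length.2 (by simpa using h3)

theorem hasSum_X0 {N a : ℕ} {r u w s : ℝ}
    (h : HasSum (fun p : ℕ × List ℕ => entryWeight u w p.1 * (p.2.map (entryWeight u w)).prod *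
      itv N a r (p.1 :: p.2)) s) :
    HasSum (fun p : ℕ × ℕ => if 2 * p.2 ≤ p.1 ∧ 1 ≤ p.2 then
      X0 N a r p.1 p.2 p.2 * u ^ (p.1 - 2 * p.2) * w ^ (2 * p.2) else 0) s := by
  classical
  have h1 := hasSum_of_hasSum_cons
    (f := fun l : List ℕ => if l = [] then 0 else (l.map (entryWeight u w)).prod * itv N a r l)
    (s := s) (by simpa using h)
  rw [if_pos rfl, zero_add] at h1
  refine (hasSum_congr ?_).2 (h1.tsum_fiberwise (fun l : List ℕ => (l.sum, l.length)))
  rintro ⟨k, n⟩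
  rw [tsum_subtype ((fun l : List ℕ => (l.sum, l.length)) ⁻¹' {(k, n)})
    fun l => if l = [] then 0 else (l.map (entryWeight u w)).prod * itv N a r l]
  dsimp only
  split_ifs with hkn
  · have hX : X0 N a r k n n = ∑' l : List ℕ,
        {l : List ℕ | IsAdmissible l ∧ l.sum = k ∧ l.length = n ∧ height l = n}.indicator
          (itv N a r) l := by
      rw [← _root_.tsum_subtype]
      rfl
    rw [hX, mul_assoc, ← tsum_mul_right]
    refine tsum_congr fun l => ?_
    simp only [Set.indicator_apply, Set.mem_ofPred_eq, Set.mem_preimage, Set.mem_singleton_iff,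
      Prod.mk.injEq, maxHeight_iff hkn.2]
    by_cases hl : l.sum = k ∧ l.length = n
    · have hl0 : l ≠ [] := by
        rintro rfl
        have := hl.2
        simp at this
        omega
      by_cases hl2 : ∀ i ∈ l, 2 ≤ i
      · rw [if_pos ⟨hl, hl2⟩, if_pos hl, if_neg hl0, (prod_map_entryWeight u w hl2).2, hl.1, hl.2]
        ring
      · rw [if_neg fun H => hl2 H.2, if_pos hl, if_neg hl0, prod_map_entryWeight_eq_zero u w hl2]
        ring
    · rw [if_neg fun H => hl H.1, if_neg hl, zero_mul]
  · refine ((tsum_congr fun l => ?_).trans tsum_zero).symm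
    simp only [Set.indicator_apply, Set.mem_preimage, Set.mem_singleton_iff, Prod.mk.injEq]
    split_ifs with hl hl0
    · rfl
    · have hl2 : ¬ ∀ i ∈ l, 2 ≤ i := fun hl2 => hkn
        ⟨hl.1 ▸ hl.2 ▸ (prod_map_entryWeight u w hl2).1, hl.2 ▸ List.length_pos_iff.2 hl0⟩
      rw [prod_map_entryWeight_eq_zero u w hl2, zero_mul]
    · rfl

theorem hasSum_entryWeight {u w x : ℝ} (h : |u * x| < 1) :
    HasSum (fun k => entryWeight u w k * x ^ k) (w ^ 2 * x ^ 2 / (1 - u * x)) := by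
  rw [← hasSum_nat_add_iff' 2]
  have h0 : ∑ i ∈ range 2, entryWeight u w i * x ^ i = 0 := by simp [sum_range_succ, entryWeight]
  rw [h0, sub_zero, div_eq_mul_inv]
  refine (hasSum_congr fun k => ?_).2
    ((hasSum_geometric_of_abs_lt_one h).mul_left (w ^ 2 * x ^ 2))
  rw [entryWeight, if_pos (by omega), Nat.add_sub_cancel]
  ring

theorem abs_entryWeight (u w : ℝ) (k : ℕ) : |entryWeight u w k| = entryWeight |u| w k := by
  unfold entryWeight
  split_ifs <;> simp [abs_mul]

theorem hasSum_log_quotient {α₁ α₂ γ₁ γ₂ z : ℂ} (hsum : α₁ + α₂ = γ₁ + γ₂)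
    (hα₁ : ‖α₁ * z‖ < 1) (hα₂ : ‖α₂ * z‖ < 1) (hγ₁ : ‖γ₁ * z‖ < 1) (hγ₂ : ‖γ₂ * z‖ < 1) :
    HasSum (fun n : ℕ => if 2 ≤ n then z ^ n / n * (α₁ ^ n + α₂ ^ n - γ₁ ^ n - γ₂ ^ n) else 0)
      (-Complex.log (1 - α₁ * z) + -Complex.log (1 - α₂ * z) - -Complex.log (1 - γ₁ * z) -
        -Complex.log (1 - γ₂ * z)) := by
  refine (hasSum_congr fun n => ?_).2 ((((Complex.hasSum_taylorSeries_neg_log hα₁).add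
    (Complex.hasSum_taylorSeries_neg_log hα₂)).sub
    (Complex.hasSum_taylorSeries_neg_log hγ₁)).sub
    (Complex.hasSum_taylorSeries_neg_log hγ₂))
  split_ifs with hn
  · simp only [mul_pow]
    ring
  · interval_cases n
    · simp
    · simp only [pow_one, Nat.cast_one, div_one]
      linear_combination -z * hsum

theorem norm_lt_half_of_quadratic {α β : ℂ} {u v ε : ℝ} (hsum : α + β = u) (hprod : α * β = v)
    (hu : |u| < ε) (hε : ε ≤ 1 / 8) (hv : |v| ≤ 1 / 8) : ‖α‖ < 1 / 2 := by
  by_contra! h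
  have h1 : α * α = u * α - v := by rw [← hsum, ← hprod]; ring
  have h2 : ‖α‖ * ‖α‖ ≤ |u| * ‖α‖ + |v| := by
    rw [← norm_mul, h1]
    refine (norm_sub_le _ _).trans_eq ?_
    simp
  nlinarith

theorem one_sub_ne_zero_of_norm_lt_one {b : ℂ} (hb : ‖b‖ < 1) : 1 - b ≠ 0 := fun h => by
  rw [← sub_eq_zero.1 h] at hb
  simp at hb

theorem exp_neg_log_quotient {α₁ α₂ γ₁ γ₂ z : ℂ}
    (hα₁ : ‖α₁ * z‖ < 1) (hα₂ : ‖α₂ * z‖ < 1) (hγ₁ : ‖γ₁ * z‖ < 1) (hγ₂ : ‖γ₂ * z‖ < 1) :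
    Complex.exp (-Complex.log (1 - α₁ * z) + -Complex.log (1 - α₂ * z) -
      -Complex.log (1 - γ₁ * z) - -Complex.log (1 - γ₂ * z)) =
      (1 - γ₁ * z) * (1 - γ₂ * z) / ((1 - α₁ * z) * (1 - α₂ * z)) := by
  have := one_sub_ne_zero_of_norm_lt_one hα₁
  have := one_sub_ne_zero_of_norm_lt_one hα₂
  rw [sub_neg_eq_add, sub_neg_eq_add, Complex.exp_add, Complex.exp_add, Complex.exp_add,
    Complex.exp_neg, Complex.exp_neg, Complex.exp_log (one_sub_ne_zero_of_norm_lt_one hα₁),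
    Complex.exp_log (one_sub_ne_zero_of_norm_lt_one hα₂),
    Complex.exp_log (one_sub_ne_zero_of_norm_lt_one hγ₁),
    Complex.exp_log (one_sub_ne_zero_of_norm_lt_one hγ₂)]
  field_simp

theorem summable_double_power {x : ℕ → ℝ} (hx : ∀ j, 0 ≤ x j) (hx1 : ∀ j, x j ≤ 1)
    (hs : Summable fun j => x j ^ 2) {α₁ α₂ γ₁ γ₂ : ℂ} (hα₁ : ‖α₁‖ < 1 / 2) (hα₂ : ‖α₂‖ < 1 / 2)
    (hγ₁ : ‖γ₁‖ < 1 / 2) (hγ₂ : ‖γ₂‖ < 1 / 2) :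
    Summable fun p : ℕ × ℕ => if 2 ≤ p.2 then
      (x p.1 : ℂ) ^ p.2 / p.2 * (α₁ ^ p.2 + α₂ ^ p.2 - γ₁ ^ p.2 - γ₂ ^ p.2) else 0 := by
  have hb := hs.mul_of_nonneg (summable_geometric_two.mul_left 4) (fun j => sq_nonneg _)
    (fun n => by positivity)
  refine Summable.of_norm_bounded hb fun ⟨j, n⟩ => ?_
  dsimp only
  split_ifs with hn
  · rw [norm_mul]
    have h1 : ‖(x j : ℂ) ^ n / n‖ ≤ x j ^ 2 := by
      rw [norm_div, norm_pow, Complex.norm_real, Real.norm_of_nonneg (hx j), Complex.norm_natCast]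
      have hn1 : (1 : ℝ) ≤ n := by exact_mod_cast one_le_two.trans hn
      exact (div_le_self (pow_nonneg (hx j) n) hn1).trans (pow_le_pow_of_le_one (hx j) (hx1 j) hn)
    have hpow : ∀ {b : ℂ}, ‖b‖ < 1 / 2 → ‖b ^ n‖ ≤ (1 / 2) ^ n := fun {b} hb => by
      rw [norm_pow]
      exact pow_le_pow_left₀ (norm_nonneg _) hb.le n
    have h2 : ‖α₁ ^ n + α₂ ^ n - γ₁ ^ n - γ₂ ^ n‖ ≤ 4 * (1 / 2) ^ n := by
      have e1 := norm_sub_le (α₁ ^ n + α₂ ^ n - γ₁ ^ n) (γ₂ ^ n)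
      have e2 := norm_sub_le (α₁ ^ n + α₂ ^ n) (γ₁ ^ n)
      have e3 := norm_add_le (α₁ ^ n) (α₂ ^ n)
      linarith [hpow hα₁, hpow hα₂, hpow hγ₁, hpow hγ₂]
    exact mul_le_mul h1 h2 (norm_nonneg _) (sq_nonneg _)
  · rw [norm_zero]
    positivity

theorem factor_quotient_eq {α₁ α₂ γ₁ γ₂ u v r z : ℂ} (hα : α₁ + α₂ = u) (hα' : α₁ * α₂ = -r * v)
    (hγ : γ₁ + γ₂ = u) (hγ' : γ₁ * γ₂ = (1 - r) * v) (hu : 1 - u * z ≠ 0)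
    (h : (1 - α₁ * z) * (1 - α₂ * z) ≠ 0) :
    1 + v * z ^ 2 / (1 - u * z) / (1 - r * (v * z ^ 2 / (1 - u * z))) =
      (1 - γ₁ * z) * (1 - γ₂ * z) / ((1 - α₁ * z) * (1 - α₂ * z)) := by
  have hd : (1 - α₁ * z) * (1 - α₂ * z) = 1 - u * z - r * (v * z ^ 2) := by
    linear_combination (-z) * hα + z ^ 2 * hα'
  have hn : (1 - γ₁ * z) * (1 - γ₂ * z) = 1 - u * z - r * (v * z ^ 2) + v * z ^ 2 := by
    linear_combination (-z) * hγ + z ^ 2 * hγ'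
  rw [hd] at h
  have he : 1 - r * (v * z ^ 2 / (1 - u * z)) =
      (1 - u * z - r * (v * z ^ 2)) / (1 - u * z) := by
    rw [sub_div, div_self hu, mul_div_assoc r]
  rw [hd, hn, he, div_div_div_cancel_right₀ hu, add_div, div_self h]

theorem tendsto_prod_exp_hasSum {x T : ℕ → ℝ} (hx : ∀ j, 0 ≤ x j) (hx1 : ∀ j, x j ≤ 1)
    (hs : Summable fun j => x j ^ 2) (hT : ∀ n, 2 ≤ n → HasSum (fun j => x j ^ n) (T n))
    {α₁ α₂ γ₁ γ₂ : ℂ} (hsum : α₁ + α₂ = γ₁ + γ₂) (hα₁ : ‖α₁‖ < 1 / 2) (hα₂ : ‖α₂‖ < 1 / 2)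
    (hγ₁ : ‖γ₁‖ < 1 / 2) (hγ₂ : ‖γ₂‖ < 1 / 2) :
    ∃ L : ℂ, HasSum (fun n : ℕ => if 2 ≤ n then
        ((T n : ℂ) / n) * (α₁ ^ n + α₂ ^ n - γ₁ ^ n - γ₂ ^ n) else 0) L ∧
      Filter.Tendsto (fun M => ∏ j ∈ range M,
        ((1 - γ₁ * x j) * (1 - γ₂ * x j) / ((1 - α₁ * x j) * (1 - α₂ * x j))))
        Filter.atTop (nhds (Complex.exp L)) := by
  have hD := (summable_double_power hx hx1 hs hα₁ hα₂ hγ₁ hγ₂).hasSum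
  have hz : ∀ (b : ℂ) (j : ℕ), ‖b‖ < 1 / 2 → ‖b * x j‖ < 1 := fun b j hb => by
    rw [norm_mul, Complex.norm_real, Real.norm_of_nonneg (hx j)]
    nlinarith [norm_nonneg b, hx j, hx1 j]
  have hlog := hD.prod_fiberwise fun j => hasSum_log_quotient (z := (x j : ℂ)) hsum
    (hz α₁ j hα₁) (hz α₂ j hα₂) (hz γ₁ j hγ₁) (hz γ₂ j hγ₂)
  refine ⟨_, ((Equiv.prodComm ℕ ℕ).hasSum_iff.2 hD).prod_fiberwise fun n => ?_, ?_⟩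
  · by_cases hn : 2 ≤ n
    · have := Complex.hasSum_ofReal.2 (hT n hn)
      simp only [Complex.ofReal_pow] at this
      simpa only [Function.comp, Equiv.prodComm_apply, Prod.swap, hn, if_true] using
        (this.div_const (n : ℂ)).mul_right (α₁ ^ n + α₂ ^ n - γ₁ ^ n - γ₂ ^ n)
    · simpa only [Function.comp, Equiv.prodComm_apply, Prod.swap, hn, if_false] using hasSum_zero
  · refine ((Complex.continuous_exp.tendsto _).comp hlog.tendsto_sum_nat).congr fun M => ?_
    simp only [Function.comp, Complex.exp_sum]
    exact prod_congr rfl fun j _ => exp_neg_log_quotient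
      (hz α₁ j hα₁) (hz α₂ j hα₂) (hz γ₁ j hγ₁) (hz γ₂ j hγ₂)

end

/-- Generating function for sums of interpolated multiple t-values of level `N`
with maximal height:
`1 + Σ_{k ≥ 2n, n ≥ 1} X₀^r(k,n,n) u^{k-2n} w^{2n}
  = exp(Σ_{n≥2} (t_{N,a}(n)/n)(α₁ⁿ + α₂ⁿ - γ₁ⁿ - γ₂ⁿ))`. -/
theorem stmt5 (N : ℕ) (hN : 1 ≤ N) (a : ℕ) (ha1 : 1 ≤ a) (ha2 : a ≤ N) (r : ℝ) :
    ∃ ε > (0 : ℝ), ∀ u w : ℝ, |u| < ε → |w| < ε →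
      ∀ α₁ α₂ γ₁ γ₂ : ℂ,
        α₁ + α₂ = (u : ℂ) → α₁ * α₂ = -(r : ℂ) * w ^ 2 →
        γ₁ + γ₂ = (u : ℂ) → γ₁ * γ₂ = (1 - (r : ℂ)) * w ^ 2 →
        Summable (fun p : ℕ × ℕ =>
          if 2 * p.2 ≤ p.1 ∧ 1 ≤ p.2 then
            X0 N a r p.1 p.2 p.2 * u ^ (p.1 - 2 * p.2) * w ^ (2 * p.2)
          else 0) ∧
        Summable (fun n : ℕ =>
          if 2 ≤ n then ((tv N a [n] : ℂ) / n) * (α₁ ^ n + α₂ ^ n - γ₁ ^ n - γ₂ ^ n)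
          else 0) ∧
        (1 + ((∑' p : ℕ × ℕ,
            if 2 * p.2 ≤ p.1 ∧ 1 ≤ p.2 then
              X0 N a r p.1 p.2 p.2 * u ^ (p.1 - 2 * p.2) * w ^ (2 * p.2)
            else 0 : ℝ) : ℂ)) =
          Complex.exp (∑' n : ℕ,
            if 2 ≤ n then ((tv N a [n] : ℂ) / n) * (α₁ ^ n + α₂ ^ n - γ₁ ^ n - γ₂ ^ n)
            else 0) := by
  set x : ℕ → ℝ := fun j => ((a + N * j : ℕ) : ℝ)⁻¹ with hxdef
  have hx : ∀ j, 0 ≤ x j := fun j => by positivity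
  have hxj : ∀ j, x j ≤ ((j + 1 : ℕ) : ℝ)⁻¹ := fun j => by
    refine inv_anti₀ (by positivity) (Nat.cast_le.2 ?_)
    nlinarith [Nat.mul_le_mul_right j hN]
  have hx1 : ∀ j, x j ≤ 1 := fun j => (hxj j).trans (inv_le_one_of_one_le₀ (by simp))
  have hs : Summable fun j => x j ^ 2 := by
    have h0 : Summable fun n : ℕ => ((n : ℝ) ^ 2)⁻¹ := Real.summable_nat_pow_inv.2 one_lt_two
    refine Summable.of_nonneg_of_le (fun j => sq_nonneg _) (fun j => ?_)
      ((summable_nat_add_iff 1).2 h0)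
    rw [← inv_pow]
    exact pow_le_pow_left₀ (hx j) (hxj j) 2
  set C := ∑' j, x j ^ 2 with hC
  have hC0 : 0 ≤ C := tsum_nonneg fun j => sq_nonneg _
  obtain ⟨ε, hε⟩ : ∃ ε : ℝ, ε = 1 / (8 * (1 + |r|) * (1 + C)) := ⟨_, rfl⟩
  have hε0 : 0 < ε := by rw [hε]; positivity
  have hε1 : ε * ((1 + |r|) * (1 + C)) = 1 / 8 := by
    rw [hε]
    field_simp
  have hε2 : ε * (1 + |r|) ≤ 1 / 8 := by
    nlinarith [mul_nonneg (mul_nonneg hε0.le (by positivity : 0 ≤ 1 + |r|)) hC0]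
  have hε3 : ε ≤ 1 / 8 := by nlinarith [mul_nonneg hε0.le (abs_nonneg r)]
  refine ⟨ε, hε0, fun u w hu hw α₁ α₂ γ₁ γ₂ hα hα' hγ hγ' => ?_⟩
  have hw2 : w ^ 2 ≤ ε ^ 2 := sq_le_sq' (by linarith [(abs_lt.1 hw).1]) (abs_lt.1 hw).2.le
  have hsmall : w ^ 2 * (1 + |r|) ≤ 1 / 8 * ε := by
    calc w ^ 2 * (1 + |r|) ≤ ε ^ 2 * (1 + |r|) := by gcongr
      _ = ε * (1 + |r|) * ε := by ring
      _ ≤ 1 / 8 * ε := by gcongr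
  have hsmall' : w ^ 2 * (1 + |r|) ≤ 1 / 8 := by linarith
  have hrα : |-r * w ^ 2| ≤ 1 / 8 := by
    rw [abs_mul, abs_neg, abs_of_nonneg (sq_nonneg w)]
    nlinarith [sq_nonneg w]
  have hrγ : |(1 - r) * w ^ 2| ≤ 1 / 8 := by
    have : |1 - r| ≤ 1 + |r| := by simpa using abs_sub (1 : ℝ) r
    rw [abs_mul, abs_of_nonneg (sq_nonneg w)]
    nlinarith [sq_nonneg w]
  have hα₁ := norm_lt_half_of_quadratic hα (v := -r * w ^ 2) (by rw [hα']; push_cast; ring)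
    hu hε3 hrα
  have hα₂ := norm_lt_half_of_quadratic ((add_comm _ _).trans hα) (v := -r * w ^ 2)
    (by rw [mul_comm, hα']; push_cast; ring) hu hε3 hrα
  have hγ₁ := norm_lt_half_of_quadratic hγ (v := (1 - r) * w ^ 2)
    (by rw [hγ']; push_cast; ring) hu hε3 hrγ
  have hγ₂ := norm_lt_half_of_quadratic ((add_comm _ _).trans hγ) (v := (1 - r) * w ^ 2)
    (by rw [mul_comm, hγ']; push_cast; ring) hu hε3 hrγ
  have hux : ∀ j, |u| * x j ≤ 1 / 8 := fun j => by
    nlinarith [hx j, hx1 j, abs_nonneg u]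
  have huj : ∀ j, |u * x j| < 1 := fun j => by
    rw [abs_mul, abs_of_nonneg (hx j)]
    linarith [hux j]
  set y : ℕ → ℝ := fun j => w ^ 2 * x j ^ 2 / (1 - u * x j) with hydef
  have hy : ∀ j, HasSum (fun k => entryWeight u w k * x j ^ k) (y j) :=
    fun j => hasSum_entryWeight (huj j)
  set ya : ℕ → ℝ := fun j => w ^ 2 * x j ^ 2 / (1 - |u| * x j) with hyadef
  have hya : ∀ j, HasSum (fun k => |entryWeight u w k| * x j ^ k) (ya j) := fun j => by
    simp only [abs_entryWeight]
    refine hasSum_entryWeight ?_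
    rw [abs_mul, abs_abs, ← abs_mul]
    exact huj j
  have hya0 : ∀ j, 0 ≤ ya j := fun j =>
    div_nonneg (by positivity) (by linarith [hux j])
  have hyale : ∀ j, ya j ≤ 2 * w ^ 2 * x j ^ 2 := fun j => by
    rw [div_le_iff₀ (by linarith [hux j])]
    have : 0 ≤ w ^ 2 * x j ^ 2 := by positivity
    nlinarith [hux j]
  have hyas : Summable ya := Summable.of_nonneg_of_le hya0 hyale (hs.mul_left _)
  have hY : ∑' j, ya j ≤ 2 * w ^ 2 * C := by
    rw [hC, ← tsum_mul_left]
    exact hyas.tsum_le_tsum hyale (hs.mul_left _)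
  have hρ : (∑' j, ya j) * (1 + |r|) < 1 := by
    calc (∑' j, ya j) * (1 + |r|) ≤ 2 * w ^ 2 * C * (1 + |r|) := by gcongr
      _ = 2 * C * (w ^ 2 * (1 + |r|)) := by ring
      _ ≤ 2 * C * (1 / 8 * ε) := by gcongr
      _ < 1 := by nlinarith [mul_nonneg (mul_nonneg hε0.le hC0) (abs_nonneg r),
          mul_nonneg hε0.le (abs_nonneg r)]
  obtain ⟨s, hsum, htends⟩ := exists_hasSum_interpSum (r := r) hx hy hya hyas.hasSum hρ
  have hX := hasSum_X0 (N := N) (a := a) (r := r) (u := u) (w := w) (hsum.prod_fiberwise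
    fun ⟨k, ks⟩ => by
      dsimp only
      by_cases hk : ∀ i ∈ k :: ks, 2 ≤ i
      · exact (hasSum_interpSum_itv hN ha1 ha2 r (fun _ => rfl) hx1 hs hk).mul_left _
      · have := prod_map_entryWeight_eq_zero u w hk
        rw [List.map_cons, List.prod_cons] at this
        simp [this])
  have htv : ∀ n, 2 ≤ n → HasSum (fun j => x j ^ n) (tv N a [n]) := fun n hn => by
    have := hasSum_headTerm_tv hN ha1 ha2 (x := x) (fun _ => rfl) hx1 hs
      (List.cons_ne_nil n []) (by simpa using hn)
    simpa only [headTerm, truncSum, mul_one] using this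
  obtain ⟨L, hL, hexp⟩ := tendsto_prod_exp_hasSum hx hx1 hs htv (hα.trans hγ.symm)
    hα₁ hα₂ hγ₁ hγ₂
  refine ⟨hX.summable, hL.summable, ?_⟩
  rw [hX.tsum_eq, hL.tsum_eq]
  have hlim := (Complex.continuous_ofReal.tendsto _).comp htends
  have hz : ∀ (b : ℂ) (j : ℕ), ‖b‖ < 1 / 2 → ‖b * x j‖ < 1 := fun b j hb => by
    rw [norm_mul, Complex.norm_real, Real.norm_of_nonneg (hx j)]
    nlinarith [norm_nonneg b, hx j, hx1 j]
  rw [← Complex.ofReal_one, ← Complex.ofReal_add]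
  refine tendsto_nhds_unique hlim (hexp.congr fun M => ?_)
  rw [Function.comp, Complex.ofReal_prod]
  refine Finset.prod_congr rfl fun j _ => ?_
  have hd := mul_ne_zero (one_sub_ne_zero_of_norm_lt_one (hz α₁ j hα₁))
    (one_sub_ne_zero_of_norm_lt_one (hz α₂ j hα₂))
  have hu0 : (1 : ℂ) - u * x j ≠ 0 := one_sub_ne_zero_of_norm_lt_one (by
    rw [← Complex.ofReal_mul, Complex.norm_real]
    exact huj j)
  rw [← factor_quotient_eq hα hα' hγ hγ' hu0 hd]
  simp only [hydef, Complex.ofReal_add, Complex.ofReal_div, Complex.ofReal_sub, Complex.ofReal_mul,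
    Complex.ofReal_pow, Complex.ofReal_one]
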